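/- There exist β₀ > 0 and a function ε(β) with ε(β) → 0 as β → ∞ such that for every β ≥ β₀ the following holds: for all finite sets V₁ ⊆ V₂ ⊂ ℤ² with 0 ∈ V₁ and every integer h ≥ 1, π_{V₂}(η_0 ≥ h) ≥ e^{−ε(β)·|∂V₁|} · π_{V₁}(η_0 ≥ h), where ∂V₁ = {x ∈ ℤ² ∖ V₁ : x is a nearest neighbor of some y ∈ V₁} is the external boundary of V₁. -/

import Mathlib

open Filter Topology Classical

noncomputable section

abbrev Site : Type := ℤ × ℤ

/-- Nearest-neighbor adjacency in `ℤ²`. -/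
def adjP (x y : Site) : Prop := |x.1 - y.1| + |x.2 - y.2| = 1

/-- The Discrete Gaussian Hamiltonian `H(η) = ∑_{x∼y} (η_x - η_y)²`, the sum running over
unordered nearest-neighbor pairs (each ordered pair is counted once, whence the factor 1/2). -/
def dgH (η : Site → ℤ) : ℝ :=
  (1 / 2) * ∑' p : Site × Site, if adjP p.1 p.2 then ((η p.1 - η p.2 : ℤ) : ℝ) ^ 2 else 0

/-- Unnormalized weight of the event `A` for the DG model on `Λ` with zero boundary conditions. -/
def dgW (β : ℝ) (Λ : Finset Site) (A : (Site → ℤ) → Prop) : ℝ :=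
  ∑' η : Site → ℤ, if (∀ x ∉ Λ, η x = 0) ∧ A η then Real.exp (-β * dgH η) else 0

/-- `π_Λ(A)`: probability of the event `A` under the DG measure on `Λ`. -/
def dgProb (β : ℝ) (Λ : Finset Site) (A : (Site → ℤ) → Prop) : ℝ :=
  dgW β Λ A / dgW β Λ (fun _ => True)

/-- `ϖ_Λ(A)`: DG measure conditioned on the floor event `η ≥ 0`. -/
def dgProbFloor (β : ℝ) (Λ : Finset Site) (A : (Site → ℤ) → Prop) : ℝ :=
  dgW β Λ (fun η => A η ∧ ∀ x, 0 ≤ η x) / dgW β Λ (fun η => ∀ x, 0 ≤ η x)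

/-- The box `Λ_L = {1,…,L}²`. -/
def box (L : ℕ) : Finset Site := Finset.Icc (1 : ℤ) (L : ℤ) ×ˢ Finset.Icc (1 : ℤ) (L : ℤ)

/-- The lattice ball `B_r = {x ∈ ℤ² : |x| ≤ r}`. -/
def ball (r : ℝ) : Finset Site :=
  ((Finset.Icc (-⌈r⌉) ⌈r⌉) ×ˢ (Finset.Icc (-⌈r⌉) ⌈r⌉)).filter
    fun x => ((x.1 : ℝ) ^ 2 + (x.2 : ℝ) ^ 2 ≤ r ^ 2)


/-- The external boundary `∂V` of a finite set `V ⊂ ℤ²`: sites outside `V` that are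
nearest neighbors of some site of `V`. -/
def extBoundary (V : Finset Site) : Finset Site :=
  ((V.image fun x => (x.1 + 1, x.2)) ∪ (V.image fun x => (x.1 - 1, x.2)) ∪
      (V.image fun x => (x.1, x.2 + 1)) ∪ (V.image fun x => (x.1, x.2 - 1))) \ V


abbrev Edg : Type := Site × Bool

def dir : Bool → Site
  | false => (1, 0)
  | true => (0, 1)

def dd (η : Site → ℤ) (e : Edg) : ℤ := η e.1 - η (e.1 + dir e.2)

def FS (η : Site → ℤ) : Prop := (Function.support η).Finite

lemma FS.dd {η : Site → ℤ} (h : FS η) : (Function.support (dd η)).Finite := by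
  have h1 : ((Function.support η) ×ˢ (Set.univ : Set Bool)).Finite := h.prod Set.finite_univ
  have h2 := h1.image (fun e : Edg => ((e.1 - dir e.2, e.2) : Edg))
  refine (h1.union h2).subset ?_
  intro e he
  by_contra hc
  simp only [Set.mem_union, not_or] at hc
  apply he
  have a1 : η e.1 = 0 := by
    by_contra h'
    exact hc.1 ⟨h', trivial⟩
  have a2 : η (e.1 + dir e.2) = 0 := by
    by_contra h'
    exact hc.2 ⟨(e.1 + dir e.2, e.2), ⟨h', trivial⟩, by simp⟩
  simp [_root_.dd, a1, a2]

def HE (η : Site → ℤ) : ℝ := ∑' e : Edg, ((dd η e : ℤ) : ℝ) ^ 2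

lemma FS.summ {η : Site → ℤ} (h : FS η) : Summable (fun e : Edg => ((_root_.dd η e : ℤ) : ℝ) ^ 2) := by
  apply summable_of_hasFiniteSupport
  refine h.dd.subset ?_
  intro e he h0
  apply he
  simp only [h0]; simp

lemma FS.add {η ζ : Site → ℤ} (h : FS η) (h' : FS ζ) : FS (η + ζ) :=
  (h.union h').subset (Function.support_add η ζ)

lemma FS.sub {η ζ : Site → ℤ} (h : FS η) (h' : FS ζ) : FS (η - ζ) :=
  (h.union h').subset (Function.support_sub η ζ)

def psi (q : Edg × Bool) : Site × Site :=
  match q.2 with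
  | false => (q.1.1, q.1.1 + dir q.1.2)
  | true => (q.1.1 + dir q.1.2, q.1.1)

lemma psi_inj : Function.Injective psi := by
  rintro ⟨⟨⟨a, b⟩, c⟩, d⟩ ⟨⟨⟨a', b'⟩, c'⟩, d'⟩ h
  cases c <;> cases d <;> cases c' <;> cases d' <;>
    simp [psi, dir] at h ⊢ <;> omega

lemma adj_range {x y : Site} (h : adjP x y) : (x, y) ∈ Set.range psi := by
  obtain ⟨a, b⟩ := x
  obtain ⟨a', b'⟩ := y
  simp only [adjP] at h
  have : (a' = a + 1 ∧ b' = b) ∨ (a = a' + 1 ∧ b' = b) ∨ (a' = a ∧ b' = b + 1) ∨ (a' = a ∧ b = b' + 1) := by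
    rcases abs_cases (a - a') with h1 | h1 <;> rcases abs_cases (b - b') with h2 | h2 <;> omega
  rcases this with ⟨h1, h2⟩ | ⟨h1, h2⟩ | ⟨h1, h2⟩ | ⟨h1, h2⟩
  · exact ⟨(((a, b), false), false), by simp [psi, dir, h1, h2]⟩
  · exact ⟨(((a', b'), false), true), by simp [psi, dir, h1, h2]⟩
  · exact ⟨(((a, b), true), false), by simp [psi, dir, h1, h2]⟩
  · exact ⟨(((a', b'), true), true), by simp [psi, dir, h1, h2]⟩

lemma psi_adj (q : Edg × Bool) : adjP (psi q).1 (psi q).2 := by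
  obtain ⟨⟨⟨a, b⟩, c⟩, d⟩ := q
  cases c <;> cases d <;> simp [psi, dir, adjP]

lemma dgH_eq {η : Site → ℤ} (h : FS η) : dgH η = HE η := by
  unfold dgH HE
  rw [← psi_inj.tsum_eq]
  · have : ∀ q : Edg × Bool, (if adjP (psi q).1 (psi q).2 then
        ((η (psi q).1 - η (psi q).2 : ℤ) : ℝ) ^ 2 else 0) = ((dd η q.1 : ℤ) : ℝ) ^ 2 := by
      intro q
      rw [if_pos (psi_adj q)]
      obtain ⟨e, d⟩ := q
      cases d
      · simp [psi, dd]
      · simp [psi, dd]; ring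
    simp_rw [this]
    rw [Summable.tsum_prod' ]
    · simp only [tsum_fintype, Fintype.sum_bool]
      rw [Summable.tsum_add h.summ h.summ]
      ring
    · apply summable_of_hasFiniteSupport
      refine (h.dd.prod (Set.finite_univ : (Set.univ : Set Bool).Finite)).subset ?_
      rintro ⟨e, d⟩ he
      refine ⟨fun h0 => he ?_, trivial⟩
      simp only [h0]; simp
    · intro e
      exact (hasSum_fintype _).summable
  · rintro ⟨x, y⟩ hp
    apply adj_range
    by_contra hc
    apply hp
    simp [hc]

lemma HE_par {η ζ : Site → ℤ} (h : FS η) (h' : FS ζ) :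
    HE (η + ζ) + HE (η - ζ) = 2 * (HE η + HE ζ) := by
  unfold HE
  rw [← Summable.tsum_add (h.add h').summ (h.sub h').summ, ← Summable.tsum_add h.summ h'.summ,
    ← tsum_mul_left]
  congr 1
  ext e
  simp only [dd, Pi.add_apply, Pi.sub_apply]
  push_cast
  ring

lemma HE_neg (η : Site → ℤ) : HE (-η) = HE η := by
  unfold HE
  congr 1
  ext e
  simp only [dd, Pi.neg_apply]
  push_cast
  ring

lemma HE_nonneg (η : Site → ℤ) : 0 ≤ HE η := tsum_nonneg fun _ => sq_nonneg _

lemma HE_add {η ζ : Site → ℤ} (h : FS η) (h' : FS ζ) (hs : ∀ e, dd η e = 0 ∨ dd ζ e = 0) :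
    HE (η + ζ) = HE η + HE ζ := by
  unfold HE
  rw [← Summable.tsum_add h.summ h'.summ]
  congr 1
  ext e
  have : dd (η + ζ) e = dd η e + dd ζ e := by simp only [dd, Pi.add_apply]; ring
  rw [this]
  rcases hs e with h0 | h0 <;> simp [h0]

/-- coercivity -/
lemma abs_le_HE {η : Site → ℤ} (h : FS η) (x : Site) : |((η x : ℤ) : ℝ)| ≤ HE η := by
  obtain ⟨a, b⟩ := x
  -- far point
  have hinj : Function.Injective (fun k : ℕ => ((a + k, b) : Site)) := by
    intro k l hkl
    simp at hkl
    exact hkl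
  have hfin : ((fun k : ℕ => ((a + k, b) : Site)) ⁻¹' (Function.support η)).Finite :=
    Set.Finite.preimage hinj.injOn h
  obtain ⟨N, hN⟩ := hfin.exists_notMem
  have hN0 : η (a + N, b) = 0 := by
    by_contra hc
    exact hN hc
  have key : ∀ n : ℕ, |η (a, b) - η (a + n, b)| ≤
      ∑ k ∈ Finset.range n, (dd η ((a + k, b), false)) ^ 2 := by
    intro n
    induction n with
    | zero => simp
    | succ n ih =>
      rw [Finset.sum_range_succ]
      have h1 : |dd η ((a + n, b), false)| ≤ (dd η ((a + n, b), false)) ^ 2 := by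
        rw [← sq_abs]
        have := abs_nonneg (dd η ((a + n, b), false))
        nlinarith [Int.le_self_sq |dd η ((a + n, b), false)|]
      have h2 : η (a, b) - η (a + (n + 1 : ℕ), b) =
          (η (a, b) - η (a + n, b)) + dd η ((a + n, b), false) := by
        simp only [dd, dir, Prod.mk_add_mk, add_zero]
        push_cast
        rw [add_assoc]
        ring
      rw [h2]
      exact (abs_add_le _ _).trans (add_le_add ih h1)
  have k := key N
  rw [hN0, sub_zero] at k
  have k' : |((η (a, b) : ℤ) : ℝ)| ≤
      ∑ k ∈ Finset.range N, ((dd η ((a + k, b), false) : ℤ) : ℝ) ^ 2 := by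
    exact_mod_cast k
  refine k'.trans ?_
  have hinj2 : Function.Injective (fun k : ℕ => (((a + k, b), false) : Edg)) := by
    intro k l hkl
    simp at hkl
    exact hkl
  have := h.summ.sum_le_tsum ((Finset.range N).map ⟨_, hinj2⟩) (fun _ _ => sq_nonneg _)
  rw [Finset.sum_map] at this
  exact this

def zo (Λ : Finset Site) : AddSubgroup (Site → ℤ) where
  carrier := {η | ∀ x ∉ Λ, η x = 0}
  add_mem' := by
    intro a b ha hb x hx
    simp [ha x hx, hb x hx]
  zero_mem' := by intro x _; rfl
  neg_mem' := by
    intro a ha x hx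
    simp [ha x hx]

lemma zo_FS {Λ : Finset Site} {η : Site → ℤ} (h : η ∈ zo Λ) : FS η := by
  refine Λ.finite_toSet.subset ?_
  intro x hx
  by_contra hc
  exact hx (h x hc)

def wt (β : ℝ) (η : Site → ℤ) : ENNReal := ENNReal.ofReal (Real.exp (-β * HE η))

def FF (β : ℝ) (Λ : Finset Site) (p : Site → ℤ) : ENNReal := ∑' η : zo Λ, wt β (p + η)

def par (u : Site → ℤ) : Site → ℤ := fun s => u s % 2

def AA (β : ℝ) (Λ : Finset Site) (c : Site → ℤ) (p : Site → ℤ) : ENNReal :=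
  ∑' u : zo Λ, if par u = c then wt (β / 2) (p + u) else 0

lemma wt_double (β : ℝ) {a b : Site → ℤ} (ha : FS a) (hb : FS b) :
    wt β a * wt β b = wt (β / 2) (a + b) * wt (β / 2) (a - b) := by
  unfold wt
  rw [← ENNReal.ofReal_mul (Real.exp_pos _).le, ← ENNReal.ofReal_mul (Real.exp_pos _).le,
    ← Real.exp_add, ← Real.exp_add]
  congr 2
  have := HE_par ha hb
  linear_combination (-β / 2) * (-this)

def dbl {Λ : Finset Site} (q : zo Λ × zo Λ) : zo Λ × zo Λ := (q.1 + q.2, q.1 - q.2)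

lemma dbl_inj {Λ : Finset Site} : Function.Injective (dbl (Λ := Λ)) := by
  rintro ⟨⟨a, ha⟩, ⟨b, hb⟩⟩ ⟨⟨a', ha'⟩, ⟨b', hb'⟩⟩ h
  simp only [dbl, Prod.mk.injEq, Subtype.ext_iff] at h ⊢
  obtain ⟨h1, h2⟩ := h
  constructor <;> funext s <;> have h1 := congrFun h1 s <;> have h2 := congrFun h2 s <;>
    simp at h1 h2 ⊢ <;> omega

lemma FF_mul (β : ℝ) (Λ : Finset Site) {p q : Site → ℤ} (hp : FS p) (hq : FS q) :
    FF β Λ p * FF β Λ q = ∑' c : Site → ℤ, AA β Λ c (p + q) * AA β Λ c (p - q) := by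
  have h1 : FF β Λ p * FF β Λ q = ∑' z : zo Λ × zo Λ, 
      wt (β / 2) (p + q + (dbl z).1) * wt (β / 2) (p - q + (dbl z).2) := by
    unfold FF
    rw [ENNReal.tsum_prod', ← ENNReal.tsum_mul_right]
    congr 1; ext η
    rw [← ENNReal.tsum_mul_left]
    congr 1; ext ζ
    rw [wt_double β (hp.add (zo_FS η.2)) (hq.add (zo_FS ζ.2))]
    simp only [dbl, AddSubgroup.coe_add, AddSubgroup.coe_sub]
    congr 2 <;> abel
  have h2 : ∑' z : zo Λ × zo Λ, 
      wt (β / 2) (p + q + (dbl z).1) * wt (β / 2) (p - q + (dbl z).2) = 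
      ∑' z : zo Λ × zo Λ, if par z.1 = par z.2 then
        wt (β / 2) (p + q + z.1) * wt (β / 2) (p - q + z.2) else 0 := by
    symm
    rw [← dbl_inj.tsum_eq]
    · congr 1; ext z
      rw [if_pos]
      funext s
      simp only [dbl, par, AddSubgroup.coe_add, AddSubgroup.coe_sub, Pi.add_apply, Pi.sub_apply]
      omega
    · rintro ⟨⟨u, hu⟩, ⟨v, hv⟩⟩ hz
      have hpar : par u = par v := by
        by_contra hc
        apply hz
        simp [hc]
      refine ⟨(⟨fun s => (u s + v s) / 2, ?_⟩, ⟨fun s => (u s - v s) / 2, ?_⟩), ?_⟩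
      · intro x hx
        simp [hu x hx, hv x hx]
      · intro x hx
        simp [hu x hx, hv x hx]
      · simp only [dbl, Prod.mk.injEq, Subtype.ext_iff]
        constructor <;> funext s <;> have h1 := congrFun hpar s <;> simp [par] at h1 ⊢ <;> omega
  rw [h1, h2, ENNReal.tsum_prod']
  unfold AA
  simp_rw [← ENNReal.tsum_mul_right, ← ENNReal.tsum_mul_left]
  conv_rhs => rw [ENNReal.tsum_comm]
  congr 1; ext u
  conv_rhs => rw [ENNReal.tsum_comm]
  congr 1; ext v
  rw [tsum_eq_single (par u)]
  · by_cases h : par u = par v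
    · simp [h]
    · simp [h, Ne.symm h]
  · intro c hc
    simp [Ne.symm hc]

lemma ennreal_amgm (a b : ENNReal) : 2 * (a * b) ≤ a * a + b * b := by
  rcases le_total a b with h | h
  · obtain ⟨d, rfl⟩ := exists_add_of_le h
    calc 2 * (a * (a + d)) ≤ 2 * (a * (a + d)) + d * d := le_self_add
      _ = _ := by ring
  · obtain ⟨d, rfl⟩ := exists_add_of_le h
    calc 2 * ((b + d) * b) ≤ 2 * ((b + d) * b) + d * d := le_self_add
      _ = _ := by ring

lemma FF_step (β : ℝ) (Λ : Finset Site) {p : Site → ℤ} (hp : FS p) :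
    2 * (FF β Λ p * FF β Λ p) ≤ FF β Λ (p + p) * FF β Λ 0 + FF β Λ 0 * FF β Λ 0 := by
  have h0 : FS 0 := by simp [FS]
  rw [FF_mul β Λ hp hp, FF_mul β Λ (hp.add hp) h0, FF_mul β Λ h0 h0, ← ENNReal.tsum_add,
    ← ENNReal.tsum_mul_left]
  apply ENNReal.tsum_le_tsum
  intro c
  simp only [sub_self, add_zero, sub_zero]
  exact ennreal_amgm _ _

lemma g_summ {c : ℝ} (hc : 0 < c) : Summable (fun n : ℤ => Real.exp (-c * |(n : ℝ)|)) := by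
  have : Summable (fun n : ℕ => Real.exp (-c * (n : ℝ))) := by
    have : ∀ n : ℕ, Real.exp (-c * (n : ℝ)) = (Real.exp (-c)) ^ n := by
      intro n; rw [← Real.exp_nat_mul]; ring_nf
    simp_rw [this]
    exact summable_geometric_of_lt_one (Real.exp_pos _).le (by rw [Real.exp_lt_one_iff]; linarith)
  rw [summable_int_iff_summable_nat_and_neg]
  constructor <;> simpa using this

lemma FF_zero_lt_top {β : ℝ} (hβ : 0 < β) (Λ : Finset Site) : FF β Λ 0 < ⊤ := by
  set c : ℝ := β / (Λ.card + 1) with hc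
  have hcpos : 0 < c := by positivity
  set g : ℤ → ENNReal := fun n => ENNReal.ofReal (Real.exp (-c * |(n : ℝ)|)) with hg
  have hgs : ∑' n, g n ≠ ⊤ := (g_summ hcpos).tsum_ofReal_ne_top
  have h1 : FF β Λ 0 ≤ ∑' η : zo Λ, ∏ x : Λ, g ((η : Site → ℤ) x) := by
    apply ENNReal.tsum_le_tsum
    intro η
    rw [zero_add, wt, hg]
    simp only
    rw [← ENNReal.ofReal_prod_of_nonneg (fun _ _ => (Real.exp_pos _).le), ← Real.exp_sum]
    apply ENNReal.ofReal_le_ofReal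
    apply Real.exp_le_exp.mpr
    rw [← Finset.mul_sum]
    have : ∑ x : Λ, |(((η : Site → ℤ) x : ℤ) : ℝ)| ≤ Λ.card * HE η := by
      calc _ ≤ ∑ x : Λ, HE (η : Site → ℤ) := Finset.sum_le_sum fun x _ => abs_le_HE (zo_FS η.2) x
        _ = _ := by simp
    have h2 : c * ∑ x : Λ, |(((η : Site → ℤ) x : ℤ) : ℝ)| ≤ c * (Λ.card * HE η) :=
      mul_le_mul_of_nonneg_left this hcpos.le
    have h3 : c * (Λ.card + 1) = β := by rw [hc]; field_simp
    have h4 := mul_nonneg hcpos.le (HE_nonneg (η : Site → ℤ))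
    nlinarith
  have h2 : ∑' η : zo Λ, ∏ x : Λ, g ((η : Site → ℤ) x) ≤ ∑' f : Λ → ℤ, ∏ x : Λ, g (f x) := by
    refine ENNReal.tsum_comp_le_tsum_of_injective
      (f := fun η : zo Λ => fun x : Λ => (η : Site → ℤ) x) ?_ (fun f : Λ → ℤ => ∏ x : Λ, g (f x))
    intro a b hab
    apply Subtype.ext
    funext s
    by_cases hs : s ∈ Λ
    · exact congrFun hab ⟨s, hs⟩
    · rw [a.2 s hs, b.2 s hs]
  have h3 : ∑' f : Λ → ℤ, ∏ x : Λ, g (f x) ≤ ∏ _x : Λ, ∑' n, g n := by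
    rw [ENNReal.tsum_eq_iSup_sum]
    apply iSup_le
    intro s
    calc ∑ f ∈ s, ∏ x : Λ, g (f x) 
        ≤ ∑ f ∈ Fintype.piFinset (fun x : Λ => s.image (fun f => f x)), ∏ x : Λ, g (f x) := by
          apply Finset.sum_le_sum_of_subset
          intro f hf
          rw [Fintype.mem_piFinset]
          intro x
          exact Finset.mem_image_of_mem _ hf
      _ = ∏ x : Λ, ∑ n ∈ s.image (fun f => f x), g n := by
          rw [Finset.prod_univ_sum]
      _ ≤ _ := by
          apply Finset.prod_le_prod'
          intro x _
          exact ENNReal.sum_le_tsum _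
  refine (h1.trans (h2.trans h3)).trans_lt ?_
  exact (ENNReal.prod_ne_top fun _ _ => hgs).lt_top

lemma zo_mono {Λ Λ' : Finset Site} (h : Λ ⊆ Λ') {η : Site → ℤ} (hη : η ∈ zo Λ) : η ∈ zo Λ' :=
  fun x hx => hη x (fun h' => hx (h h'))

lemma FF_le_big (β : ℝ) (Λ Q : Finset Site) {p : Site → ℤ} (hp : p ∈ zo Q) :
    FF β Λ p ≤ FF β (Λ ∪ Q) 0 := by
  unfold FF
  have := ENNReal.tsum_comp_le_tsum_of_injective
    (f := fun η : zo Λ => (⟨p + η, (zo (Λ ∪ Q)).add_mem (zo_mono Finset.subset_union_right hp)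
      (zo_mono Finset.subset_union_left η.2)⟩ : zo (Λ ∪ Q))) (by
        intro a b hab
        simp only [Subtype.mk.injEq, add_right_inj] at hab
        exact Subtype.ext hab) (fun ζ : zo (Λ ∪ Q) => wt β (0 + ζ))
  simpa using this

lemma FF_le_zero {β : ℝ} (hβ : 0 < β) (Λ Q : Finset Site) {p : Site → ℤ} (hp : p ∈ zo Q) :
    FF β Λ p ≤ FF β Λ 0 := by
  set M : ENNReal := ⨆ q : zo Q, FF β Λ q with hM
  have hMtop : M < ⊤ := lt_of_le_of_lt (iSup_le fun q => FF_le_big β Λ Q q.2)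
    (FF_zero_lt_top hβ _)
  have h0top := FF_zero_lt_top hβ Λ
  have hle : ∀ q ∈ zo Q, FF β Λ q ≤ M := fun q hq => le_iSup (fun q : zo Q => FF β Λ q) ⟨q, hq⟩
  refine (hle p hp).trans ?_
  set m := M.toReal
  set z := (FF β Λ 0).toReal
  have hz0 : 0 ≤ z := ENNReal.toReal_nonneg
  have hm0 : 0 ≤ m := ENNReal.toReal_nonneg
  have key : ∀ q ∈ zo Q, (FF β Λ q).toReal ≤ Real.sqrt ((m * z + z * z) / 2) := by
    intro q hq
    apply Real.le_sqrt_of_sq_le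
    have h1 := FF_step β Λ (zo_FS hq)
    have h2 : FF β Λ (q + q) * FF β Λ 0 ≤ M * FF β Λ 0 :=
      mul_le_mul_left (hle _ ((zo Q).add_mem hq hq)) _
    have h3 := h1.trans (add_le_add_left h2 _)
    have h4 := ENNReal.toReal_mono (by
      exact ENNReal.add_ne_top.mpr ⟨ENNReal.mul_ne_top hMtop.ne h0top.ne,
        ENNReal.mul_ne_top h0top.ne h0top.ne⟩) h3
    rw [ENNReal.toReal_add (ENNReal.mul_ne_top hMtop.ne h0top.ne)
        (ENNReal.mul_ne_top h0top.ne h0top.ne)] at h4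
    simp only [ENNReal.toReal_mul, ENNReal.toReal_ofNat] at h4
    rw [sq]
    change 2 * _ ≤ m * z + z * z at h4
    linarith
  have hMle : m ≤ Real.sqrt ((m * z + z * z) / 2) := by
    have : M ≤ ENNReal.ofReal (Real.sqrt ((m * z + z * z) / 2)) := by
      apply iSup_le
      intro q
      rw [ENNReal.le_ofReal_iff_toReal_le ((hle q q.2).trans_lt hMtop).ne (Real.sqrt_nonneg _)]
      exact key q q.2
    exact ENNReal.toReal_le_of_le_ofReal (Real.sqrt_nonneg _) this
  have hsq : m ^ 2 ≤ (m * z + z * z) / 2 := by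
    have := pow_le_pow_left₀ hm0 hMle 2
    rwa [Real.sq_sqrt (by positivity)] at this
  rw [← ENNReal.toReal_le_toReal hMtop.ne h0top.ne]
  change m ≤ z
  by_contra hc
  push Not at hc
  nlinarith

def bd (D : Finset Site) : Finset Edg :=
  ((D ×ˢ (Finset.univ : Finset Bool)) ∪
    (D ×ˢ (Finset.univ : Finset Bool)).image (fun e : Edg => ((e.1 - dir e.2, e.2) : Edg))).filter
    (fun e => ¬ (e.1 ∈ D ↔ e.1 + dir e.2 ∈ D))

lemma mem_bd {D : Finset Site} {e : Edg} : e ∈ bd D ↔ ¬ (e.1 ∈ D ↔ e.1 + dir e.2 ∈ D) := by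
  unfold bd
  rw [Finset.mem_filter]
  refine ⟨fun h => h.2, fun h => ⟨?_, h⟩⟩
  rw [Finset.mem_union]
  by_cases h1 : e.1 ∈ D
  · left
    simp [h1]
  · right
    have h2 : e.1 + dir e.2 ∈ D := by tauto
    rw [Finset.mem_image]
    exact ⟨(e.1 + dir e.2, e.2), by simp [h2], by simp⟩

def plaq (s : Site) : Finset Edg :=
  {(s, false), (s + (0, 1), false), (s, true), (s + (1, 0), true)}

def RR (e f : Edg) : Prop := ∃ q, e ∈ plaq q ∧ f ∈ plaq q

def ind (T : Finset Edg) (e : Edg) : ZMod 2 := if e ∈ T then 1 else 0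

def indD (D : Finset Site) (s : Site) : ZMod 2 := if s ∈ D then 1 else 0

def EvenP (T : Finset Edg) : Prop := ∀ s : Site,
  ind T (s, false) + ind T (s + (0, 1), false) + ind T (s, true) + ind T (s + (1, 0), true) = 0

lemma z2 (z : ZMod 2) : z = 0 ∨ z = 1 := by revert z; decide

lemma ind_bd (D : Finset Site) (e : Edg) : ind (bd D) e = indD D e.1 + indD D (e.1 + dir e.2) := by
  unfold ind indD
  by_cases h1 : e.1 ∈ D <;> by_cases h2 : e.1 + dir e.2 ∈ D <;> simp [mem_bd, h1, h2] <;> decide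

lemma ind_ext {T T' : Finset Edg} (h : ∀ e, ind T e = ind T' e) : T = T' := by
  ext e
  have := h e
  unfold ind at this
  by_cases h1 : e ∈ T <;> by_cases h2 : e ∈ T' <;> simp_all

/-- the height function of a closed set of edges -/
def gg (T : Finset Edg) (a b : ℤ) : ZMod 2 :=
  ∑ e ∈ T, if e.2 = false ∧ e.1.2 = b ∧ a ≤ e.1.1 then 1 else 0

lemma gg_hor (T : Finset Edg) (a b : ℤ) : gg T a b = gg T (a + 1) b + ind T ((a, b), false) := by
  have : ind T ((a, b), false) = ∑ e ∈ T, if e = ((a, b), false) then 1 else 0 := by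
    simp [ind]
  rw [this, gg, gg, ← Finset.sum_add_distrib]
  apply Finset.sum_congr rfl
  rintro ⟨⟨a', b'⟩, c⟩ _
  cases c
  · simp only [Prod.mk.injEq, true_and, and_true]
    by_cases hb : b' = b
    · rcases lt_trichotomy a a' with h | h | h
      · simp [hb, h.le, h, h.ne']
      · simp [hb, h]
      · simp [hb, not_le.mpr h, h.ne]; omega
    · simp [hb]
  · simp

lemma gg_vert (T : Finset Edg) (hT : EvenP T) (M : ℤ) (hM : ∀ e ∈ T, |e.1.1| ≤ M ∧ |e.1.2| ≤ M)
    (a b : ℤ) : gg T a b + gg T a (b + 1) = ind T ((a, b), true) := by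
  have base : ∀ a > M, gg T a b + gg T a (b + 1) = ind T ((a, b), true) := by
    intro a ha
    have hg : ∀ b, gg T a b = 0 := by
      intro b
      apply Finset.sum_eq_zero
      intro e he
      rw [if_neg]
      have := (abs_le.mp (hM e he).1).2
      omega
    rw [hg, hg, ind, if_neg]
    · simp
    · intro he
      have := (abs_le.mp (hM _ he).1).2
      simp only at this
      omega
  have main : ∀ n : ℕ, gg T (M + 1 - n) b + gg T (M + 1 - n) (b + 1) = 
      ind T ((M + 1 - n, b), true) := by
    intro n
    induction n with
    | zero => simpa using base (M + 1) (by omega)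
    | succ n ih =>
      have e1 : M + 1 - ((n + 1 : ℕ) : ℤ) + 1 = M + 1 - n := by push_cast; ring
      rw [gg_hor T (M + 1 - ((n + 1 : ℕ) : ℤ)) b, gg_hor T (M + 1 - ((n + 1 : ℕ) : ℤ)) (b + 1), e1]
      have h := hT (M + 1 - ((n + 1 : ℕ) : ℤ), b)
      simp only [Prod.mk_add_mk, add_zero, e1] at h
      have two : (2 : ZMod 2) = 0 := rfl
      linear_combination ih + h - (ind T ((M + 1 - ((n + 1 : ℕ) : ℤ), b), true)) * two
  rcases le_or_gt a M with h | h
  · have := main (M + 1 - a).toNat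
    have e : M + 1 - ((M + 1 - a).toNat : ℤ) = a := by omega
    rwa [e] at this
  · exact base a h

lemma poincare (T : Finset Edg) (hT : EvenP T) : ∃ D : Finset Site, bd D = T := by
  obtain ⟨M, hM⟩ : ∃ M : ℤ, ∀ e ∈ T, |e.1.1| ≤ M ∧ |e.1.2| ≤ M := by
    refine ⟨∑ e ∈ T, (|e.1.1| + |e.1.2|), fun e he => ?_⟩
    have := Finset.single_le_sum (f := fun e : Edg => |e.1.1| + |e.1.2|)
      (fun e _ => add_nonneg (abs_nonneg _) (abs_nonneg _)) he
    have h1 := abs_nonneg e.1.1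
    have h2 := abs_nonneg e.1.2
    constructor <;> linarith
  have hv := gg_vert T hT M hM
  have z1 : ∀ a b, (b < -M ∨ M < b) → gg T a b = 0 := by
    intro a b h
    apply Finset.sum_eq_zero
    intro e he
    rw [if_neg]
    have := (abs_le.mp (hM e he).2)
    omega
  have z2' : ∀ a b, M < a → gg T a b = 0 := by
    intro a b h
    apply Finset.sum_eq_zero
    intro e he
    rw [if_neg]
    have := (abs_le.mp (hM e he).1)
    omega
  have z3 : ∀ a b, a < -M → gg T a b = 0 := by
    intro a b h
    have : ∀ n : ℕ, gg T a (M + 1 - n) = 0 := by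
      intro n
      induction n with
      | zero => exact z1 _ _ (Or.inr (by simp))
      | succ n ih =>
        have := hv a (M + 1 - ((n + 1 : ℕ) : ℤ))
        have e1 : M + 1 - ((n + 1 : ℕ) : ℤ) + 1 = M + 1 - n := by push_cast; ring
        rw [e1, ih, add_zero] at this
        rw [this, ind, if_neg]
        intro he
        have := (abs_le.mp (hM _ he).1)
        simp only at this
        omega
    rcases le_or_gt b M with hb | hb
    · have := this (M + 1 - b).toNat
      have e : M + 1 - ((M + 1 - b).toNat : ℤ) = b := by omega
      rwa [e] at this
    · exact z1 _ _ (Or.inr hb)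
  refine ⟨(Finset.Icc (-M) M ×ˢ Finset.Icc (-M) M).filter (fun s => gg T s.1 s.2 = 1), ?_⟩
  set D := (Finset.Icc (-M) M ×ˢ Finset.Icc (-M) M).filter (fun s => gg T s.1 s.2 = 1) with hD
  have hg : ∀ a b, indD D (a, b) = gg T a b := by
    intro a b
    unfold indD
    rcases z2 (gg T a b) with h | h
    · rw [if_neg, h]
      simp [hD, h]
    · rw [if_pos, h]
      simp only [hD, Finset.mem_filter, Finset.mem_product, Finset.mem_Icc, h, and_true]
      by_contra hc
      have : gg T a b = 0 := by
        by_cases c1 : b < -M ∨ M < b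
        · exact z1 _ _ c1
        by_cases c2 : M < a
        · exact z2' _ _ c2
        · exact z3 _ _ (by omega)
      rw [this] at h
      exact absurd h (by decide)
  apply ind_ext
  rintro ⟨⟨a, b⟩, c⟩
  rw [ind_bd]
  have two : (2 : ZMod 2) = 0 := rfl
  cases c
  · simp only [dir, Prod.mk_add_mk, add_zero, hg]
    rw [gg_hor T a b]
    linear_combination (gg T (a + 1) b) * two
  · simp only [dir, Prod.mk_add_mk, add_zero, hg]
    exact hv a b

def Rin (S : Finset Edg) (a b : Edg) : Prop := a ∈ S ∧ b ∈ S ∧ RR a b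

def comp (S : Finset Edg) (e : Edg) : Finset Edg :=
  S.filter (fun f => Relation.ReflTransGen (Rin S) e f)

lemma even_bd (D : Finset Site) : EvenP (bd D) := by
  intro s
  simp only [ind_bd, dir]
  have two : (2 : ZMod 2) = 0 := rfl
  have : s + (0, 1) + (1, 0) = s + (1, 0) + (0, 1) := by abel
  rw [this]
  linear_combination (indD D s + indD D (s + (1, 0)) + indD D (s + (0, 1)) + indD D (s + (1, 0) + (0, 1))) * two

lemma even_comp {S : Finset Edg} (hS : EvenP S) (e : Edg) : EvenP (comp S e) := by
  intro s
  by_cases h : ∃ f ∈ plaq s, f ∈ comp S e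
  · obtain ⟨f, hf, hfc⟩ := h
    have key : ∀ f' ∈ plaq s, ind (comp S e) f' = ind S f' := by
      intro f' hf'
      unfold ind
      congr 1
      apply propext
      refine ⟨fun h => (Finset.mem_filter.mp h).1, fun h => ?_⟩
      obtain ⟨h1, h2⟩ := Finset.mem_filter.mp hfc
      exact Finset.mem_filter.mpr ⟨h, h2.tail ⟨h1, h, s, hf, hf'⟩⟩
    rw [key _ (by simp [plaq]), key _ (by simp [plaq]), key _ (by simp [plaq]),
      key _ (by simp [plaq])]
    exact hS s
  · push Not at h
    have key : ∀ f' ∈ plaq s, ind (comp S e) f' = 0 := fun f' hf' => if_neg (h f' hf')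
    rw [key _ (by simp [plaq]), key _ (by simp [plaq]), key _ (by simp [plaq]),
      key _ (by simp [plaq])]
    simp

lemma bd_symm {D D1 : Finset Site} (hsub : bd D1 ⊆ bd D) :
    bd (symmDiff D D1) = bd D \ bd D1 := by
  ext a
  have hs := @hsub a
  rw [Finset.mem_sdiff]
  simp only [mem_bd, Finset.mem_symmDiff] at hs ⊢
  clear hsub
  by_cases h1 : a.1 ∈ D <;> by_cases h2 : a.1 ∈ D1 <;> by_cases h3 : a.1 + dir a.2 ∈ D <;>
    by_cases h4 : a.1 + dir a.2 ∈ D1 <;> simp only [h1, h2, h3, h4] at hs ⊢ <;> simp at hs ⊢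

lemma peel (x : Site) : ∀ n : ℕ, ∀ D : Finset Site, (bd D).card = n → x ∈ D →
    ∃ D' : Finset Site, x ∈ D' ∧ bd D' ⊆ bd D ∧
      ∀ e ∈ bd D', ∀ f ∈ bd D', Relation.ReflTransGen (Rin (bd D')) e f := by
  intro n
  induction n using Nat.strong_induction_on with
  | _ n ih =>
    intro D hn hx
    by_cases hc : ∀ e ∈ bd D, ∀ f ∈ bd D, Relation.ReflTransGen (Rin (bd D)) e f
    · exact ⟨D, hx, subset_rfl, hc⟩
    push Not at hc
    obtain ⟨e, he, f, hf, hef⟩ := hc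
    obtain ⟨D1, hD1⟩ := poincare _ (even_comp (even_bd D) e)
    have hsub : bd D1 ⊆ bd D := by rw [hD1]; exact Finset.filter_subset _ _
    have hfn : f ∉ bd D1 := by
      rw [hD1]; intro h; exact hef (Finset.mem_filter.mp h).2
    have hee : e ∈ bd D1 := by
      rw [hD1]; exact Finset.mem_filter.mpr ⟨he, Relation.ReflTransGen.refl⟩
    by_cases hx1 : x ∈ D1
    · have hlt : (bd D1).card < n := by
        rw [← hn]
        exact Finset.card_lt_card ⟨hsub, fun h => hfn (h hf)⟩
      obtain ⟨D', h1, h2, h3⟩ := ih _ hlt D1 rfl hx1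
      exact ⟨D', h1, h2.trans hsub, h3⟩
    · have hb := bd_symm hsub
      have hlt : (bd (symmDiff D D1)).card < n := by
        rw [← hn, hb]
        exact Finset.card_lt_card ⟨Finset.sdiff_subset, fun h => (Finset.mem_sdiff.mp (h he)).2 hee⟩
      obtain ⟨D', h1, h2, h3⟩ := ih _ hlt (symmDiff D D1) rfl
        (by rw [Finset.mem_symmDiff]; exact Or.inl ⟨hx, hx1⟩)
      exact ⟨D', h1, h2.trans (by rw [hb]; exact Finset.sdiff_subset), h3⟩

lemma ray1 (D : Finset Site) (b : Bool) {s : Site} (hs : s ∈ D) :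
    ∃ k : ℕ, (s + k • dir b, b) ∈ bd D ∧ ∀ j ≤ k, s + j • dir b ∈ D := by
  have hinj : Function.Injective (fun k : ℕ => s + k • dir b) := by
    intro k l hkl
    cases b <;> simpa [dir] using hkl
  have hfin : ((fun k : ℕ => s + k • dir b) ⁻¹' (D : Set Site)).Finite :=
    Set.Finite.preimage hinj.injOn D.finite_toSet
  have hex : ∃ k : ℕ, s + (k + 1) • dir b ∉ D := by
    obtain ⟨N, hN⟩ := hfin.exists_notMem
    cases N with
    | zero => exact absurd hs (by simpa using hN)
    | succ N => exact ⟨N, hN⟩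
  have hall : ∀ j ≤ Nat.find hex, s + j • dir b ∈ D := by
    intro j hj
    cases j with
    | zero => simpa using hs
    | succ j => exact not_not.mp (Nat.find_min hex (by omega))
  refine ⟨Nat.find hex, ?_, hall⟩
  rw [mem_bd]
  have h1 := hall _ le_rfl
  have h2 := Nat.find_spec hex
  rw [add_smul, one_smul, ← add_assoc] at h2
  simp only
  tauto

lemma ray2 (D : Finset Site) {x : Site} (hx : x ∈ D) :
    ∃ k : ℕ, k < (bd D).card ∧ (x + k • dir false, false) ∈ bd D := by
  obtain ⟨k, hk, hall⟩ := ray1 D false hx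
  refine ⟨k, ?_, hk⟩
  have : ∀ j : ℕ, ∃ i : ℕ, j ≤ k → (x + j • dir false + i • dir true, true) ∈ bd D := by
    intro j
    by_cases hj : j ≤ k
    · obtain ⟨i, hi, _⟩ := ray1 D true (hall j hj)
      exact ⟨i, fun _ => hi⟩
    · exact ⟨0, fun h => absurd h hj⟩
  choose i hi using this
  have := Finset.card_le_card_of_injOn (s := Finset.range (k + 1)) (t := bd D)
    (fun j => (x + j • dir false + i j • dir true, true))
    (fun j hj => hi j (by simpa [Nat.lt_succ_iff] using hj)) (by
      intro a _ b _ hab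
      simp only [Prod.mk.injEq, and_true] at hab
      have := congrArg Prod.fst hab
      simpa [dir] using this)
  rw [Finset.card_range] at this
  omega

def nb (e : Edg) : Finset Edg :=
  match e.2 with
  | false => plaq e.1 ∪ plaq (e.1 - (0, 1))
  | true => plaq e.1 ∪ plaq (e.1 - (1, 0))

lemma card_nb (e : Edg) : (nb e).card ≤ 8 := by
  have h : ∀ s, (plaq s).card ≤ 4 := fun s => Finset.card_le_four
  obtain ⟨s, b⟩ := e
  cases b <;> exact (Finset.card_union_le _ _).trans (add_le_add (h _) (h _))

lemma RR_nb {e f : Edg} (h : RR e f) : f ∈ nb e := by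
  obtain ⟨q, he, hf⟩ := h
  obtain ⟨s, b⟩ := e
  cases b
  · have : q = s ∨ q = s - (0, 1) := by
      simp only [plaq, Finset.mem_insert, Finset.mem_singleton, Prod.mk.injEq] at he
      rcases he with h | h | h | h
      · exact Or.inl h.1.symm
      · exact Or.inr (by rw [h.1]; abel)
      · exact absurd h.2 (by simp)
      · exact absurd h.2 (by simp)
    rcases this with rfl | rfl
    · exact Finset.mem_union_left _ hf
    · exact Finset.mem_union_right _ hf
  · have : q = s ∨ q = s - (1, 0) := by
      simp only [plaq, Finset.mem_insert, Finset.mem_singleton, Prod.mk.injEq] at he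
      rcases he with h | h | h | h
      · exact absurd h.2 (by simp)
      · exact absurd h.2 (by simp)
      · exact Or.inl h.1.symm
      · exact Or.inr (by rw [h.1]; abel)
    rcases this with rfl | rfl
    · exact Finset.mem_union_left _ hf
    · exact Finset.mem_union_right _ hf

lemma RR_symm {e f : Edg} (h : RR e f) : RR f e := by
  obtain ⟨q, he, hf⟩ := h
  exact ⟨q, hf, he⟩

def WW : ℕ → Edg → Finset (Finset Edg)
  | 0, e => {{e}}
  | m + 1, e => (nb e).biUnion (fun f => (WW m f).image (fun S => insert e S))

lemma card_WW (m : ℕ) : ∀ e, (WW m e).card ≤ 8 ^ m := by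
  induction m with
  | zero => intro e; simp [WW]
  | succ m ih =>
    intro e
    rw [WW]
    calc _ ≤ ∑ f ∈ nb e, ((WW m f).image (fun S => insert e S)).card := Finset.card_biUnion_le
      _ ≤ ∑ f ∈ nb e, 8 ^ m := Finset.sum_le_sum fun f _ => Finset.card_image_le.trans (ih f)
      _ = (nb e).card * 8 ^ m := by simp
      _ ≤ 8 * 8 ^ m := Nat.mul_le_mul_right _ (card_nb e)
      _ = _ := by ring

lemma chain_WW (l : List Edg) : ∀ e, List.IsChain RR (e :: l) → (e :: l).toFinset ∈ WW l.length e := by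
  induction l with
  | nil => intro e _; simp [WW]
  | cons f l ih =>
    intro e h
    rw [List.isChain_cons_cons] at h
    rw [List.length_cons, WW, Finset.mem_biUnion]
    refine ⟨f, RR_nb h.1, ?_⟩
    rw [Finset.mem_image]
    exact ⟨_, ih f h.2, by rw [List.toFinset_cons (a := e)]⟩

lemma exists_cross {S T : Finset Edg} {e f : Edg} (h : Relation.ReflTransGen (Rin S) e f)
    (he : e ∈ T) (hf : f ∉ T) : ∃ a ∈ T, ∃ b ∉ T, Rin S a b := by
  induction h with
  | refl => exact absurd he hf
  | @tail b c _ hbc ih =>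
    by_cases hb : b ∈ T
    · exact ⟨b, hb, c, hf, hbc⟩
    · exact ih hb

lemma grow {S : Finset Edg} {e : Edg} (he : e ∈ S)
    (hS : ∀ f ∈ S, Relation.ReflTransGen (Rin S) e f) (m : ℕ) (hm : m < S.card) :
    ∃ l : List Edg, l.head? = some e ∧ List.IsChain RR l ∧ l.length = 2 * m + 1 ∧
      l.toFinset ⊆ S ∧ l.toFinset.card = m + 1 := by
  induction m with
  | zero => exact ⟨[e], by simp [he]⟩
  | succ m ih =>
    obtain ⟨l, h1, h2, h3, h4, h5⟩ := ih (by omega)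
    obtain ⟨f, hf, hfl⟩ : ∃ f ∈ S, f ∉ l.toFinset := by
      by_contra hc
      push Not at hc
      have := Finset.card_le_card (show S ⊆ l.toFinset from hc)
      omega
    have hel : e ∈ l.toFinset := by
      rw [List.mem_toFinset]
      exact List.mem_of_mem_head? h1
    obtain ⟨u, hu, w, hw, hr⟩ := exists_cross (hS f hf) hel hfl
    obtain ⟨l1, l2, rfl⟩ := List.append_of_mem (List.mem_toFinset.mp hu)
    have hfs : (l1 ++ u :: w :: u :: l2).toFinset = insert w (l1 ++ u :: l2).toFinset := by
      ext a
      simp only [List.mem_toFinset, List.mem_append, List.mem_cons, Finset.mem_insert]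
      tauto
    refine ⟨l1 ++ u :: w :: u :: l2, ?_, ?_, ?_, ?_, ?_⟩
    · cases l1 <;> simpa using h1
    · rw [List.isChain_split] at h2 ⊢
      refine ⟨h2.1, ?_⟩
      rw [List.isChain_cons_cons, List.isChain_cons_cons]
      exact ⟨hr.2.2, RR_symm hr.2.2, h2.2⟩
    · simp only [List.length_append, List.length_cons] at h3 ⊢
      omega
    · rw [hfs]
      exact Finset.insert_subset hr.2.1 h4
    · rw [hfs, Finset.card_insert_of_notMem hw, h5]

lemma conn_WW {S : Finset Edg} {e : Edg} (he : e ∈ S)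
    (hS : ∀ f ∈ S, Relation.ReflTransGen (Rin S) e f) {m : ℕ} (hm : S.card = m + 1) :
    S ∈ WW (2 * m) e := by
  obtain ⟨l, h1, h2, h3, h4, h5⟩ := grow he hS m (by omega)
  have : l.toFinset = S := Finset.eq_of_subset_of_card_le h4 (by omega)
  cases l with
  | nil => simp at h1
  | cons a l =>
    simp only [List.head?_cons, Option.some.injEq] at h1
    subst h1
    have := chain_WW l _ h2
    simp only [List.length_cons, add_left_inj] at h3
    rw [h3] at this
    simp_all

/-- candidate contours around `x` of length `m+1` -/
def GG (x : Site) (m : ℕ) : Finset (Finset Edg) :=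
  (Finset.range (m + 1)).biUnion (fun k => WW (2 * m) (x + k • dir false, false))

lemma card_GG (x : Site) (m : ℕ) : (GG x m).card ≤ 128 ^ (m + 1) := by
  have h1 : (GG x m).card ≤ (m + 1) * 8 ^ (2 * m) := by
    calc _ ≤ ∑ k ∈ Finset.range (m + 1), (WW (2 * m) (x + k • dir false, false)).card :=
          Finset.card_biUnion_le
      _ ≤ ∑ k ∈ Finset.range (m + 1), 8 ^ (2 * m) := Finset.sum_le_sum fun _ _ => card_WW _ _
      _ = _ := by simp
  have h2 : m + 1 ≤ 2 ^ (m + 1) := Nat.lt_two_pow_self.le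
  calc _ ≤ _ := h1
    _ ≤ 2 ^ (m + 1) * 8 ^ (2 * (m + 1)) :=
        Nat.mul_le_mul h2 (Nat.pow_le_pow_right (by norm_num) (by omega))
    _ = _ := by rw [pow_mul, ← mul_pow]; norm_num

/-- Contour extraction. -/
lemma exists_contour (D : Finset Site) {x : Site} (hx : x ∈ D) :
    ∃ m, ∃ γ ∈ GG x m, γ.card = m + 1 ∧ γ ⊆ bd D ∧ ∃ D' : Finset Site, bd D' = γ := by
  obtain ⟨D', hx', hsub, hconn⟩ := peel x _ D rfl hx
  obtain ⟨k, hk, hke⟩ := ray2 D' hx'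
  refine ⟨(bd D').card - 1, bd D', ?_, by omega, hsub, D', rfl⟩
  rw [GG, Finset.mem_biUnion]
  exact ⟨k, by rw [Finset.mem_range]; omega, conn_WW hke (hconn _ hke) (by omega)⟩

def UU (Λ : Finset Site) (η : Site → ℤ) : Finset Site := Λ.filter (fun s => 1 ≤ η s)

lemma mem_UU {Λ : Finset Site} {η : Site → ℤ} (h : η ∈ zo Λ) {s : Site} :
    s ∈ UU Λ η ↔ 1 ≤ η s := by
  unfold UU
  rw [Finset.mem_filter]
  refine ⟨fun h => h.2, fun hs => ⟨?_, hs⟩⟩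
  by_contra hc
  rw [h s hc] at hs
  omega

def rfl0 (D Λ : Finset Site) (η : zo Λ) : zo Λ :=
  ⟨fun s => if s ∈ D then (if s ∈ Λ then 1 - (η : Site → ℤ) s else 0) else (η : Site → ℤ) s, by
    intro x hx
    simp [hx, η.2 x hx]⟩

def pp (D Λ : Finset Site) : Site → ℤ := fun s => if s ∈ D ∧ s ∉ Λ then 1 else 0

lemma pp_mem (D Λ : Finset Site) : pp D Λ ∈ zo D := by
  intro x hx
  simp [pp, hx]

lemma rfl0_inj (D Λ : Finset Site) : Function.Injective (rfl0 D Λ) := by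
  intro a b h
  apply Subtype.ext
  funext s
  have := congrFun (congrArg Subtype.val h) s
  by_cases hs : s ∈ Λ
  · by_cases hd : s ∈ D
    · simp [rfl0, hs, hd] at this
      exact this
    · simpa [rfl0, hs, hd] using this
  · rw [a.2 s hs, b.2 s hs]

lemma rfl0_val (D Λ : Finset Site) (η : zo Λ) (s : Site) :
    (pp D Λ + rfl0 D Λ η) s = if s ∈ D then 1 - (η : Site → ℤ) s else (η : Site → ℤ) s := by
  by_cases hs : s ∈ Λ <;> by_cases hd : s ∈ D <;> simp [rfl0, pp, hs, hd] <;>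
    simp [η.2 s hs]

lemma HE_drop (D Λ : Finset Site) (η : zo Λ) (h : bd D ⊆ bd (UU Λ η)) :
    HE (pp D Λ + rfl0 D Λ η) + (bd D).card ≤ HE η := by
  have hs1 : FS (pp D Λ + rfl0 D Λ η) := (zo_FS (pp_mem D Λ)).add (zo_FS (rfl0 D Λ η).2)
  have hI : HasSum (fun e : Edg => if e ∈ bd D then (1 : ℝ) else 0) (bd D).card := by
    have := hasSum_sum_of_ne_finset_zero (L := SummationFilter.unconditional _) (f := fun e : Edg => if e ∈ bd D then (1 : ℝ) else 0)
      (s := bd D) (fun e he => if_neg he)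
    simpa using this
  unfold HE
  rw [← hI.tsum_eq, ← Summable.tsum_add hs1.summ hI.summable]
  refine Summable.tsum_le_tsum ?_ (hs1.summ.add hI.summable) (zo_FS η.2).summ
  intro e
  have key : (dd (pp D Λ + rfl0 D Λ η) e) ^ 2 + (if e ∈ bd D then 1 else 0) ≤
      (dd (η : Site → ℤ) e) ^ 2 := by
    have hd := @mem_bd D e
    have hu := @h e
    rw [mem_bd, mem_bd, mem_UU η.2, mem_UU η.2] at hu
    simp only [dd, rfl0_val]
    generalize (η : Site → ℤ) e.1 = a at *
    generalize (η : Site → ℤ) (e.1 + dir e.2) = b at *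
    by_cases h1 : e.1 ∈ D <;> by_cases h2 : e.1 + dir e.2 ∈ D <;>
      simp only [h1, h2, hd] at hu ⊢ <;> simp at hu ⊢
    · nlinarith
    all_goals
      rcases le_or_gt 1 a with ha | ha
      · have hb : ¬ 1 ≤ b := fun hb => hu ⟨fun _ => hb, fun _ => ha⟩
        nlinarith
      · have hb : 1 ≤ b := by
          by_contra hb
          exact hu ⟨fun h => absurd h (by omega), fun h => absurd h hb⟩
        nlinarith
  exact_mod_cast key

lemma peierls1 {β : ℝ} (hβ : 0 < β) (D Λ : Finset Site) :
    (∑' η : zo Λ, if bd D ⊆ bd (UU Λ η) then wt β η else 0) ≤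
      ENNReal.ofReal (Real.exp (-β * (bd D).card)) * FF β Λ 0 := by
  calc _ ≤ ∑' η : zo Λ, ENNReal.ofReal (Real.exp (-β * (bd D).card)) *
          wt β (pp D Λ + rfl0 D Λ η) := by
        apply ENNReal.tsum_le_tsum
        intro η
        split_ifs with h
        · unfold wt
          rw [← ENNReal.ofReal_mul (Real.exp_pos _).le, ← Real.exp_add]
          apply ENNReal.ofReal_le_ofReal
          apply Real.exp_le_exp.mpr
          have := HE_drop D Λ η h
          nlinarith
        · exact zero_le
    _ = ENNReal.ofReal (Real.exp (-β * (bd D).card)) *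
          ∑' η : zo Λ, wt β (pp D Λ + rfl0 D Λ η) := ENNReal.tsum_mul_left
    _ ≤ ENNReal.ofReal (Real.exp (-β * (bd D).card)) * FF β Λ (pp D Λ) := by
        gcongr
        exact ENNReal.tsum_comp_le_tsum_of_injective (rfl0_inj D Λ)
          (fun ζ : zo Λ => wt β (pp D Λ + ζ))
    _ ≤ _ := by
        gcongr
        exact FF_le_zero hβ Λ D (pp_mem D Λ)

def ZE (β : ℝ) (Λ : Finset Site) (A : (Site → ℤ) → Prop) : ENNReal :=
  ∑' η : zo Λ, if A η then wt β η else 0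

lemma ZE_true (β : ℝ) (Λ : Finset Site) : ZE β Λ (fun _ => True) = FF β Λ 0 := by
  simp [ZE, FF]

lemma peierls2 {β : ℝ} (hβ : 0 < β) (hr : 128 * Real.exp (-β) ≤ 1 / 2) (Λ : Finset Site) (x : Site) :
    ZE β Λ (fun η => 1 ≤ η x) ≤ ENNReal.ofReal (2 * (128 * Real.exp (-β))) * FF β Λ 0 := by
  set P : ℕ → Finset Edg → Prop := fun m γ => γ.card = m + 1 ∧ ∃ D', bd D' = γ with hP
  have h1 : ZE β Λ (fun η => 1 ≤ η x) ≤ ∑' η : zo Λ, ∑' m : ℕ, ∑ γ ∈ GG x m,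
      if P m γ ∧ γ ⊆ bd (UU Λ η) then wt β η else 0 := by
    apply ENNReal.tsum_le_tsum
    intro η
    split_ifs with h
    · obtain ⟨m, γ, hγ, hc, hsub, hD⟩ := exists_contour (UU Λ η) ((mem_UU η.2).mpr h)
      refine le_trans ?_ (ENNReal.le_tsum m)
      refine le_trans ?_ (Finset.single_le_sum (fun _ _ => zero_le) hγ)
      rw [if_pos ⟨⟨hc, hD⟩, hsub⟩]
    · exact zero_le
  refine h1.trans ?_
  rw [ENNReal.tsum_comm]
  have h2 : ∀ m : ℕ, (∑' η : zo Λ, ∑ γ ∈ GG x m,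
      if P m γ ∧ γ ⊆ bd (UU Λ η) then wt β η else 0) ≤
      ENNReal.ofReal ((128 * Real.exp (-β)) * (1 / 2) ^ m) * FF β Λ 0 := by
    intro m
    rw [Summable.tsum_finsetSum (fun _ _ => ENNReal.summable)]
    calc _ ≤ ∑ γ ∈ GG x m, ENNReal.ofReal (Real.exp (-β * (m + 1 : ℕ))) * FF β Λ 0 := by
          apply Finset.sum_le_sum
          intro γ _
          by_cases hp : P m γ
          · obtain ⟨hc, D', rfl⟩ := hp
            have hpp := peierls1 hβ D' Λ
            rw [hc] at hpp
            refine le_trans ?_ hpp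
            apply ENNReal.tsum_le_tsum
            intro η
            by_cases hh : bd D' ⊆ bd (UU Λ η)
            · rw [if_pos hh]; split_ifs
              · exact le_rfl
              · exact zero_le
            · rw [if_neg (fun h => hh h.2)]; exact zero_le
          · simp [hp]
      _ = (GG x m).card * ENNReal.ofReal (Real.exp (-β * (m + 1 : ℕ))) * FF β Λ 0 := by
          rw [Finset.sum_const, nsmul_eq_mul, mul_assoc]
      _ ≤ _ := by
          gcongr
          rw [← ENNReal.ofReal_natCast, ← ENNReal.ofReal_mul (by positivity)]
          apply ENNReal.ofReal_le_ofReal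
          have hc : ((GG x m).card : ℝ) ≤ 128 ^ (m + 1) := by exact_mod_cast card_GG x m
          have he : Real.exp (-β * (m + 1 : ℕ)) = Real.exp (-β) ^ (m + 1) := by
            rw [← Real.exp_nat_mul]; ring_nf
          rw [he]
          calc _ ≤ (128 : ℝ) ^ (m + 1) * Real.exp (-β) ^ (m + 1) := by gcongr
            _ = (128 * Real.exp (-β)) * (128 * Real.exp (-β)) ^ m := by
              rw [← mul_pow, pow_succ]; ring
            _ ≤ _ := by gcongr
  refine (ENNReal.tsum_le_tsum h2).trans ?_
  rw [ENNReal.tsum_mul_right]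
  gcongr
  rw [← ENNReal.ofReal_tsum_of_nonneg (fun m => by positivity)
    (summable_geometric_two.mul_left _), tsum_mul_left, tsum_geometric_two]
  apply le_of_eq
  congr 1
  ring

lemma ZE_neg (β : ℝ) (Λ : Finset Site) (A : (Site → ℤ) → Prop) :
    ZE β Λ (fun η => A (-η)) = ZE β Λ A := by
  unfold ZE
  rw [← (Equiv.neg (zo Λ)).tsum_eq]
  congr 1
  ext η
  simp [wt, HE_neg]

lemma ZE_full (β : ℝ) (Λ : Finset Site) (A : (Site → ℤ) → Prop) :
    ZE β Λ A = ∑' η : Site → ℤ, if (∀ x ∉ Λ, η x = 0) ∧ A η then wt β η else 0 := by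
  unfold ZE
  rw [← (Subtype.val_injective (p := fun η => η ∈ zo Λ)).tsum_eq]
  · congr 1
    ext η
    have : (∀ x ∉ Λ, (η : Site → ℤ) x = 0) := η.2
    by_cases hA : A η
    · rw [if_pos hA, if_pos ⟨this, hA⟩]
    · rw [if_neg hA, if_neg (fun h => hA h.2)]
  · intro η hη
    have : η ∈ zo Λ := by
      by_contra hc
      apply hη
      exact if_neg (fun h => hc h.1)
    exact ⟨⟨η, this⟩, rfl⟩

lemma dgW_eq (β : ℝ) (Λ : Finset Site) (A : (Site → ℤ) → Prop) :
    dgW β Λ A = (ZE β Λ A).toReal := by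
  rw [ZE_full, ENNReal.tsum_toReal_eq]
  · unfold dgW
    congr 1
    ext η
    split_ifs with h
    · rw [wt, ENNReal.toReal_ofReal (Real.exp_pos _).le, dgH_eq (zo_FS (Λ := Λ) h.1)]
    · simp
  · intro η
    split_ifs
    · exact ENNReal.ofReal_ne_top
    · simp

lemma ZE_erase (β : ℝ) (Λ : Finset Site) (x : Site) :
    ZE β Λ (fun η => η x = 0) = FF β (Λ.erase x) 0 := by
  rw [← ZE_true, ZE_full, ZE_full]
  congr 1
  ext η
  congr 1
  apply propext
  constructor
  · rintro ⟨h1, h2⟩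
    refine ⟨fun y hy => ?_, trivial⟩
    by_cases hyx : y = x
    · rw [hyx, h2]
    · exact h1 y (fun h => hy (Finset.mem_erase.mpr ⟨hyx, h⟩))
  · rintro ⟨h1, _⟩
    exact ⟨fun y hy => h1 y (fun h => hy (Finset.mem_of_mem_erase h)), h1 x (by simp)⟩

def ZR (β : ℝ) (Λ : Finset Site) : ℝ := (FF β Λ 0).toReal

lemma ZR_pos {β : ℝ} (hβ : 0 < β) (Λ : Finset Site) : 0 < ZR β Λ := by
  apply ENNReal.toReal_pos _ (FF_zero_lt_top hβ Λ).ne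
  intro h
  have h1 : wt β (0 + (0 : zo Λ)) ≤ FF β Λ 0 := ENNReal.le_tsum (f := fun η : zo Λ => wt β (0 + η)) 0
  rw [h] at h1
  simp only [wt, nonpos_iff_eq_zero, ENNReal.ofReal_eq_zero] at h1
  exact absurd h1 (not_le.mpr (Real.exp_pos _))

lemma erase_step {β : ℝ} (hβ : 0 < β) (hr : 128 * Real.exp (-β) ≤ 1 / 2) (Λ : Finset Site)
    (x : Site) : (1 - 4 * (128 * Real.exp (-β))) * ZR β Λ ≤ ZR β (Λ.erase x) := by
  have hp := peierls2 hβ hr Λ x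
  have hn : ZE β Λ (fun η => 1 ≤ (-η) x) ≤ _ := (ZE_neg β Λ (fun η => 1 ≤ η x)).le.trans hp
  have hsum : FF β Λ 0 ≤ FF β (Λ.erase x) 0 +
      (ZE β Λ (fun η => 1 ≤ η x) + ZE β Λ (fun η => 1 ≤ (-η) x)) := by
    rw [← ZE_erase]
    unfold ZE FF
    rw [← ENNReal.tsum_add, ← ENNReal.tsum_add]
    apply ENNReal.tsum_le_tsum
    intro η
    rw [zero_add]
    rcases lt_trichotomy ((η : Site → ℤ) x) 0 with h | h | h
    · have h' : 1 ≤ (-(η : Site → ℤ)) x := by simp; omega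
      rw [if_pos h']
      exact le_add_left (le_add_left le_rfl)
    · rw [if_pos h]
      exact le_add_right le_rfl
    · have h' : 1 ≤ (η : Site → ℤ) x := by omega
      rw [if_pos h']
      exact le_add_left (le_add_right le_rfl)
  have h3 := hsum.trans (add_le_add le_rfl (add_le_add hp hn))
  have ht := (FF_zero_lt_top hβ Λ).ne
  have ht' := (FF_zero_lt_top hβ (Λ.erase x)).ne
  have hm := ENNReal.mul_ne_top (ENNReal.ofReal_ne_top (r := 2 * (128 * Real.exp (-β)))) ht
  have h4 := ENNReal.toReal_mono (ENNReal.add_ne_top.mpr ⟨ht', ENNReal.add_ne_top.mpr ⟨hm, hm⟩⟩) h3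
  rw [ENNReal.toReal_add ht' (ENNReal.add_ne_top.mpr ⟨hm, hm⟩), ENNReal.toReal_add hm hm,
    ENNReal.toReal_mul, ENNReal.toReal_ofReal (by positivity)] at h4
  unfold ZR
  linarith

lemma sdiff_step {β : ℝ} (hβ : 0 < β) (hr : 128 * Real.exp (-β) ≤ 1 / 8) (Λ S : Finset Site) :
    (1 - 4 * (128 * Real.exp (-β))) ^ S.card * ZR β Λ ≤ ZR β (Λ \ S) := by
  induction S using Finset.induction_on with
  | empty => simp
  | insert a S ha ih =>
    rw [Finset.card_insert_of_notMem ha, Finset.sdiff_insert, pow_succ']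
    refine le_trans ?_ (erase_step hβ (by linarith) (Λ \ S) a)
    rw [mul_assoc]
    exact mul_le_mul_of_nonneg_left ih (by linarith)

lemma ZE_prod (β : ℝ) (V W : Finset Site) (hd : Disjoint V W)
    (hsep : ∀ η ∈ zo V, ∀ ζ ∈ zo W, ∀ e, dd η e = 0 ∨ dd ζ e = 0) (A : (Site → ℤ) → Prop)
    (hA : ∀ η ∈ zo V, ∀ ζ ∈ zo W, (A (η + ζ) ↔ A η)) :
    ZE β (V ∪ W) A = ZE β V A * FF β W 0 := by
  unfold ZE FF
  rw [← ENNReal.tsum_mul_right]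
  simp_rw [← ENNReal.tsum_mul_left]
  rw [← ENNReal.tsum_prod]
  let φ : zo V × zo W → zo (V ∪ W) := fun q => ⟨q.1 + q.2,
    (zo (V ∪ W)).add_mem (zo_mono Finset.subset_union_left q.1.2)
      (zo_mono Finset.subset_union_right q.2.2)⟩
  have hφ : Function.Injective φ := by
    rintro ⟨⟨a, ha⟩, ⟨b, hb⟩⟩ ⟨⟨a', ha'⟩, ⟨b', hb'⟩⟩ h
    have h := congrArg Subtype.val h
    simp only [φ] at h
    simp only [Prod.mk.injEq, Subtype.mk.injEq]
    constructor <;> funext s <;> have hs := congrFun h s <;> simp only [Pi.add_apply] at hs <;>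
      by_cases hV : s ∈ V
    · have hW := Finset.disjoint_left.mp hd hV
      rw [hb s hW, hb' s hW] at hs
      omega
    · rw [ha s hV, ha' s hV]
    · have hW := Finset.disjoint_left.mp hd hV
      rw [hb s hW, hb' s hW]
    · rw [ha s hV, ha' s hV] at hs
      omega
  rw [← hφ.tsum_eq]
  · congr 1
    ext q
    obtain ⟨η, ζ⟩ := q
    simp only [φ, hA η η.2 ζ ζ.2, zero_add]
    split_ifs
    · unfold wt
      rw [← ENNReal.ofReal_mul (Real.exp_pos _).le, ← Real.exp_add,
        HE_add (zo_FS η.2) (zo_FS ζ.2) (hsep η η.2 ζ ζ.2)]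
      ring_nf
    · simp
  · rintro ⟨ζ, hζ⟩ _
    refine ⟨(⟨fun s => if s ∈ V then ζ s else 0, ?_⟩, ⟨fun s => if s ∈ V then 0 else ζ s, ?_⟩), ?_⟩
    · intro s hs; simp [hs]
    · intro s hs
      by_cases hV : s ∈ V
      · simp [hV]
      · simp only [hV, if_false]
        exact hζ s (by simp [hs, hV])
    · apply Subtype.ext
      funext s
      simp only [φ, Pi.add_apply]
      by_cases hV : s ∈ V <;> simp [hV]

lemma ext_mem {V : Finset Site} {s : Site} {b : Bool} :
    (s ∈ V → s + dir b ∈ V ∪ extBoundary V) ∧ (s + dir b ∈ V → s ∈ V ∪ extBoundary V) := by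
  obtain ⟨a, c⟩ := s
  constructor
  · intro h
    by_cases h' : (a, c) + dir b ∈ V
    · exact Finset.mem_union_left _ h'
    · apply Finset.mem_union_right
      rw [extBoundary, Finset.mem_sdiff]
      refine ⟨?_, h'⟩
      simp only [Finset.mem_union, Finset.mem_image]
      cases b
      · exact Or.inl (Or.inl (Or.inl ⟨_, h, by simp [dir]⟩))
      · exact Or.inl (Or.inr ⟨_, h, by simp [dir]⟩)
  · intro h
    by_cases h' : (a, c) ∈ V
    · exact Finset.mem_union_left _ h'
    · apply Finset.mem_union_right
      rw [extBoundary, Finset.mem_sdiff]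
      refine ⟨?_, h'⟩
      simp only [Finset.mem_union, Finset.mem_image]
      cases b
      · exact Or.inl (Or.inl (Or.inr ⟨_, h, by simp [dir]⟩))
      · exact Or.inr ⟨_, h, by simp [dir]⟩

lemma sep {V W : Finset Site} (hW : Disjoint (V ∪ extBoundary V) W) :
    ∀ η ∈ zo V, ∀ ζ ∈ zo W, ∀ e, dd η e = 0 ∨ dd ζ e = 0 := by
  intro η hη ζ hζ e
  by_cases h1 : e.1 ∈ V
  · right
    have a1 := hζ _ (Finset.disjoint_left.mp hW (Finset.mem_union_left _ h1))
    have a2 := hζ _ (Finset.disjoint_left.mp hW ((ext_mem (b := e.2)).1 h1))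
    simp [dd, a1, a2]
  by_cases h2 : e.1 + dir e.2 ∈ V
  · right
    have a1 := hζ _ (Finset.disjoint_left.mp hW (Finset.mem_union_left _ h2))
    have a2 := hζ _ (Finset.disjoint_left.mp hW (ext_mem.2 h2))
    simp [dd, a1, a2]
  · left
    simp [dd, hη _ h1, hη _ h2]

lemma ZE_le_FF (β : ℝ) (Λ : Finset Site) (A : (Site → ℤ) → Prop) : ZE β Λ A ≤ FF β Λ 0 := by
  rw [← ZE_true]
  apply ENNReal.tsum_le_tsum
  intro η
  rw [if_pos trivial]
  split_ifs
  · exact le_rfl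
  · exact zero_le

lemma ZE_mono (β : ℝ) {Λ Λ' : Finset Site} (h : Λ ⊆ Λ') (A : (Site → ℤ) → Prop) :
    ZE β Λ A ≤ ZE β Λ' A := by
  rw [ZE_full, ZE_full]
  apply ENNReal.tsum_le_tsum
  intro η
  by_cases hη : (∀ x ∉ Λ, η x = 0) ∧ A η
  · rw [if_pos hη, if_pos ⟨fun x hx => hη.1 x (fun h' => hx (h h')), hη.2⟩]
  · rw [if_neg hη]; exact zero_le

lemma final_ineq {β : ℝ} (hβ : 0 < β) (hr : 128 * Real.exp (-β) ≤ 1 / 8) (V₁ V₂ : Finset Site)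
    (hV : V₁ ⊆ V₂) (A : (Site → ℤ) → Prop)
    (hA : ∀ η ζ : Site → ℤ, (∀ x ∈ V₁, ζ x = 0) → (A (η + ζ) ↔ A η)) :
    Real.exp (-(8 * (128 * Real.exp (-β))) * ((extBoundary V₁).card : ℝ)) * dgProb β V₁ A ≤
      dgProb β V₂ A := by
  set S := extBoundary V₁ with hS
  set W := V₂ \ (V₁ ∪ S) with hW
  have hdis : Disjoint (V₁ ∪ S) W := Finset.disjoint_sdiff
  have hd1 : Disjoint V₁ W := Finset.disjoint_of_subset_left Finset.subset_union_left hdis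
  have hVS : ∀ s ∈ V₁, s ∉ S := fun s hs hs' => (Finset.mem_sdiff.mp hs').2 hs
  have hun : V₂ \ S = V₁ ∪ W := by
    ext s
    have := hVS s
    have := @hV s
    simp only [hW, Finset.mem_sdiff, Finset.mem_union]
    tauto
  have hprod := fun B hB => ZE_prod β V₁ W hd1 (sep hdis) B hB
  have pA := hprod A (fun η _ ζ hζ => hA η ζ (fun x hx => hζ x (Finset.disjoint_left.mp hd1 hx)))
  have pT := hprod (fun _ => True) (by simp)
  rw [ZE_true, ZE_true, ← hun] at pT
  rw [← hun] at pA
  have hm := ZE_mono β (Finset.sdiff_subset : V₂ \ S ⊆ V₂) A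
  rw [pA] at hm
  have hst := sdiff_step hβ hr V₂ S
  have hm' := ENNReal.toReal_mono ((ZE_le_FF β V₂ A).trans_lt (FF_zero_lt_top hβ V₂)).ne hm
  rw [ENNReal.toReal_mul] at hm'
  have pT' : ZR β (V₂ \ S) = ZR β V₁ * ZR β W := by
    unfold ZR; rw [pT, ENNReal.toReal_mul]
  rw [pT'] at hst
  unfold dgProb
  simp only [dgW_eq, ZE_true]
  change _ * (_ / ZR β V₁) ≤ _ / ZR β V₂
  change _ * ZR β W ≤ _ at hm'
  have z1 := ZR_pos hβ V₁
  have z2 := ZR_pos hβ V₂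
  set r := 128 * Real.exp (-β) with hrdef
  have hr0 : 0 < r := by positivity
  have hexp : Real.exp (-(8 * r) * (S.card : ℝ)) ≤ (1 - 4 * r) ^ S.card := by
    have : Real.exp (-(8 * r) * (S.card : ℝ)) = Real.exp (-(8 * r)) ^ S.card := by
      rw [← Real.exp_nat_mul]; ring_nf
    rw [this]
    apply pow_le_pow_left₀ (Real.exp_pos _).le
    rw [Real.exp_neg]
    have h1 := Real.add_one_le_exp (8 * r)
    rw [inv_le_iff_one_le_mul₀ (Real.exp_pos _)]
    nlinarith
  set w1 := (ZE β V₁ A).toReal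
  have hw1 : 0 ≤ w1 := ENNReal.toReal_nonneg
  rw [le_div_iff₀ z2, mul_div_assoc', div_mul_eq_mul_div, div_le_iff₀ z1]
  calc _ = w1 * (Real.exp (-(8 * r) * (S.card : ℝ)) * ZR β V₂) := by ring
    _ ≤ w1 * ((1 - 4 * r) ^ S.card * ZR β V₂) := by gcongr
    _ ≤ w1 * (ZR β V₁ * ZR β W) := by gcongr
    _ = (w1 * ZR β W) * ZR β V₁ := by ring
    _ ≤ _ := by gcongr

/-- Monotonicity in the region: `π_{V₂}(η_0 ≥ h) ≥ e^{−ε(β)|∂V₁|} π_{V₁}(η_0 ≥ h)`. -/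
theorem dg_region_comparison :
    ∃ β₀ > (0 : ℝ), ∃ ε : ℝ → ℝ, Tendsto ε atTop (𝓝 0) ∧
      ∀ β ≥ β₀, ∀ V₁ V₂ : Finset Site, V₁ ⊆ V₂ → (0, 0) ∈ V₁ → ∀ h : ℕ, 1 ≤ h →
        Real.exp (-ε β * ((extBoundary V₁).card : ℝ)) *
            dgProb β V₁ (fun η => (h : ℤ) ≤ η (0, 0)) ≤
          dgProb β V₂ (fun η => (h : ℤ) ≤ η (0, 0)) := by
  refine ⟨Real.log 1024, Real.log_pos (by norm_num), fun β => 8 * (128 * Real.exp (-β)), ?_, ?_⟩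
  · have h : Tendsto (fun β : ℝ => Real.exp (-β)) atTop (𝓝 0) :=
      Real.tendsto_exp_neg_atTop_nhds_zero
    simpa using (h.const_mul 128).const_mul 8
  · intro β hβ V₁ V₂ hV h0 h _
    have hpos : 0 < β := lt_of_lt_of_le (Real.log_pos (by norm_num)) hβ
    have hr : 128 * Real.exp (-β) ≤ 1 / 8 := by
      have : Real.exp (-β) ≤ Real.exp (-Real.log 1024) := Real.exp_le_exp.mpr (by linarith)
      rw [Real.exp_neg (Real.log 1024), Real.exp_log (by norm_num)] at this
      linarith
    refine final_ineq hpos hr V₁ V₂ hV _ ?_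
    intro η ζ hζ
    simp [hζ _ h0]
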